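/- Let T be a tree on the vertex set {1,…,n} with n ≥ 2. Then there exists a permutation that is the product of exactly one edge ordering of T (a cycle of multiplicity 1 in C(T)) if and only if T is a caterpillar, i.e., the subgraph of T induced on the vertices of degree at least 2 is a path (possibly empty or a single vertex). (Theorem 3.2.) -/

import Mathlib

/-- The transposition of `Sₙ` corresponding to an edge (an unordered pair) of a graph
on the vertex set `Fin n`. -/
def edgePerm {n : ℕ} (e : Sym2 (Fin n)) : Equiv.Perm (Fin n) :=
  Sym2.lift ⟨fun i j => Equiv.swap i j, fun i j => Equiv.swap_comm i j⟩ e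

/-- The product of the transpositions of a list of edges, the first edge applied first. -/
def listProd {n : ℕ} (l : List (Sym2 (Fin n))) : Equiv.Perm (Fin n) :=
  (l.map edgePerm).reverse.prod

/-- `l` is an edge ordering of the graph `T`: a duplicate-free list containing
exactly the edges of `T`. -/
def IsEdgeOrdering {n : ℕ} (T : SimpleGraph (Fin n)) (l : List (Sym2 (Fin n))) : Prop :=
  l.Nodup ∧ ∀ e, e ∈ l ↔ e ∈ T.edgeSet
/-- `T` is a caterpillar: the subgraph induced on the vertices of degree at least 2
is a path (possibly empty or a single vertex), i.e. it is acyclic, preconnected, and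
all its vertices have degree at most 2. -/
def IsCaterpillar {n : ℕ} (T : SimpleGraph (Fin n)) : Prop :=
  (T.induce {v : Fin n | 2 ≤ (T.neighborSet v).ncard}).IsAcyclic ∧
  (T.induce {v : Fin n | 2 ≤ (T.neighborSet v).ncard}).Preconnected ∧
  ∀ v, ((T.induce {v : Fin n | 2 ≤ (T.neighborSet v).ncard}).neighborSet v).ncard ≤ 2

/-- Two edges meet if they share a vertex. -/
def EdgesMeet {V : Type*} (e f : Sym2 V) : Prop := ∃ x, x ∈ e ∧ x ∈ f

section Permutations

variable {n : ℕ}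

@[simp] theorem edgePerm_mk (x y : Fin n) : edgePerm s(x, y) = Equiv.swap x y := rfl

theorem listProd_cons (e : Sym2 (Fin n)) (l : List (Sym2 (Fin n))) :
    listProd (e :: l) = listProd l * edgePerm e := by
  simp [listProd]

theorem listProd_append (l₁ l₂ : List (Sym2 (Fin n))) :
    listProd (l₁ ++ l₂) = listProd l₂ * listProd l₁ := by
  simp [listProd]

theorem edgePerm_commute_of_not_edgesMeet {e f : Sym2 (Fin n)} (h : ¬ EdgesMeet e f) :
    Commute (edgePerm e) (edgePerm f) := by
  induction e with | _ a b
  induction f with | _ c d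
  refine Equiv.Perm.Disjoint.commute fun x => ?_
  by_contra! hx
  have h₁ := Equiv.swap_apply_ne_self_iff.mp hx.1
  have h₂ := Equiv.swap_apply_ne_self_iff.mp hx.2
  exact h ⟨x, by simpa using h₁.2, by simpa using h₂.2⟩

/-- The product of a list of edges of `G` preserves the connected components of `G`. -/
theorem reachable_listProd {G : SimpleGraph (Fin n)} {l : List (Sym2 (Fin n))}
    (hl : ∀ e ∈ l, e ∈ G.edgeSet) (v : Fin n) : G.Reachable v (listProd l v) := by
  induction l generalizing v with
  | nil => simp [listProd]
  | cons e r ih =>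
    rw [listProd_cons, Equiv.Perm.mul_apply]
    refine .trans ?_ (ih (fun f hf => hl f (by simp [hf])) _)
    have he := hl e (by simp)
    induction e with | _ a b
    rw [SimpleGraph.mem_edgeSet] at he
    rw [edgePerm_mk]
    by_cases ha : v = a
    · subst ha; simpa using he.reachable
    by_cases hb : v = b
    · subst hb; simpa using he.symm.reachable
    rw [Equiv.swap_apply_of_ne_of_ne ha hb]

/-- In an acyclic graph, a product of distinct edges moves the endpoints of the first edge. -/
theorem listProd_cons_apply_ne {T : SimpleGraph (Fin n)} (hT : T.IsAcyclic)
    {e : Sym2 (Fin n)} {l : List (Sym2 (Fin n))} (hnd : (e :: l).Nodup)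
    (hl : ∀ f ∈ e :: l, f ∈ T.edgeSet) {x : Fin n} (hx : x ∈ e) :
    listProd (e :: l) x ≠ x := by
  obtain ⟨z, rfl⟩ := Sym2.mem_iff_exists.mp hx
  intro h
  have hadj : T.Adj x z := hl s(x, z) (by simp)
  have hb := SimpleGraph.isAcyclic_iff_forall_adj_isBridge.mp hT hadj
  rw [SimpleGraph.isBridge_iff] at hb
  have hr := reachable_listProd (G := T.deleteEdges {s(x, z)}) (l := l) (by
    intro f hf
    rw [SimpleGraph.edgeSet_deleteEdges]
    refine ⟨hl f (by simp [hf]), ?_⟩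
    rintro rfl
    simp at hnd
    exact hnd.1 hf) z
  rw [listProd_cons, Equiv.Perm.mul_apply, edgePerm_mk, Equiv.swap_apply_left] at h
  rw [h] at hr
  exact hb hr.symm

/-- If consecutive edges of `l` meet, then `l` is the only ordering of its edges with the
same product. -/
theorem eq_of_listProd_eq {T : SimpleGraph (Fin n)} (hT : T.IsAcyclic)
    {l l' : List (Sym2 (Fin n))} (hnd : l.Nodup) (hl : ∀ e ∈ l, e ∈ T.edgeSet)
    (hc : l.IsChain EdgesMeet) (hp : l'.Perm l) (hprod : listProd l' = listProd l) : l' = l := by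
  induction l generalizing l' with
  | nil => simpa using hp
  | cons e r ih =>
    obtain ⟨p, q, rfl⟩ := List.append_of_mem (hp.mem_iff.mpr List.mem_cons_self)
    have hpq : (p ++ q).Perm r := (List.perm_middle.symm.trans hp).cons_inv
    have hnd' := hpq.nodup_iff.mpr hnd.of_cons
    have hrT : ∀ f ∈ r, f ∈ (T.deleteEdges {e}).edgeSet := by
      intro f hf
      rw [SimpleGraph.edgeSet_deleteEdges]
      refine ⟨hl f (by simp [hf]), ?_⟩
      rintro rfl
      exact (List.nodup_cons.mp hnd).1 hf
    have hpT : ∀ f ∈ p, f ∈ (T.deleteEdges {e}).edgeSet := fun f hf =>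
      hrT f (hpq.mem_iff.mp (by simp [hf]))
    have hqT : ∀ f ∈ q, f ∈ (T.deleteEdges {e}).edgeSet := fun f hf =>
      hrT f (hpq.mem_iff.mp (by simp [hf]))
    have heT := hl e (by simp)
    rw [listProd_append, listProd_cons, listProd_cons] at hprod
    have fixes : ∀ x ∈ e, listProd p x = x := by
      intro x hx
      obtain ⟨y, rfl⟩ := Sym2.mem_iff_exists.mp hx
      have hb := SimpleGraph.isAcyclic_iff_forall_adj_isBridge.mp hT heT
      rw [SimpleGraph.isBridge_iff] at hb
      have happ := congrArg (fun σ : Equiv.Perm (Fin n) => σ x) hprod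
      simp only [Equiv.Perm.mul_apply, edgePerm_mk, Equiv.swap_apply_left] at happ
      have h₁ := reachable_listProd hpT x
      have h₂ := reachable_listProd hrT y
      by_contra hne
      by_cases hy : listProd p x = y
      · exact hb (hy ▸ h₁)
      · rw [Equiv.swap_apply_of_ne_of_ne hne hy] at happ
        have h₃ := reachable_listProd hqT (listProd p x)
        rw [happ] at h₃
        exact hb (h₁.trans (h₃.trans h₂.symm))
    have hcomm : listProd p * edgePerm e = edgePerm e * listProd p := by
      induction e with | _ x y
      rw [edgePerm_mk, Equiv.mul_swap_eq_swap_mul, fixes x (by simp), fixes y (by simp)]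
    have hprod' : listProd (p ++ q) = listProd r := by
      rw [listProd_append]
      refine mul_right_cancel (b := edgePerm e) ?_
      rw [← hprod, mul_assoc, mul_assoc, hcomm]
    have hpqr := ih hnd.of_cons (fun f hf => hl f (by simp [hf])) hc.tail hpq hprod'
    cases p with
    | nil => simpa using hpqr
    | cons f p' =>
      exfalso
      subst hpqr
      obtain ⟨x, hxe, hxf⟩ := (List.isChain_cons_cons.mp hc).1
      refine listProd_cons_apply_ne hT (hnd'.sublist (List.sublist_append_left _ _)) ?_ hxf
        (fixes x hxe)
      intro g hg
      exact hl g (by rw [List.mem_cons]; exact .inr (List.mem_append_left _ hg))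

/-- An edge ordering of a graph which is determined by its product has meeting
consecutive edges. -/
theorem isChain_edgesMeet_of_unique {T : SimpleGraph (Fin n)} {l : List (Sym2 (Fin n))}
    (hl : IsEdgeOrdering T l)
    (huniq : ∀ l', IsEdgeOrdering T l' → listProd l' = listProd l → l' = l) :
    l.IsChain EdgesMeet := by
  rw [List.isChain_iff_forall_rel_of_append_cons_cons]
  rintro e f p q rfl
  by_contra h
  have hperm : (p ++ f :: e :: q).Perm (p ++ e :: f :: q) :=
    (List.Perm.swap e f q).append_left p
  have heq := huniq (p ++ f :: e :: q)
    ⟨hperm.nodup_iff.mpr hl.1, fun g => hperm.mem_iff.trans (hl.2 g)⟩ (by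
      simp only [listProd_append, listProd_cons, mul_assoc]
      rw [(edgePerm_commute_of_not_edgesMeet h).left_comm])
  have hfe : f = e := by simp at heq; exact heq.1
  have := (List.nodup_append.mp hl.1).2.1
  simp [hfe] at this

end Permutations

section Graphs

variable {V : Type*}

/-- A list of edges sharing a vertex `u`, followed by a list starting with an edge at `u`,
keeps consecutive edges meeting. -/
theorem isChain_edgesMeet_append {u : V} {l₁ l₂ : List (Sym2 V)} (h₁ : ∀ e ∈ l₁, u ∈ e)
    (h₂ : l₂.IsChain EdgesMeet) (hhead : ∀ e ∈ l₂.head?, u ∈ e) :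
    (l₁ ++ l₂).IsChain EdgesMeet := by
  refine List.IsChain.append ?_ h₂ fun e he f hf =>
    ⟨u, h₁ e (List.mem_of_mem_getLast? he), hhead f hf⟩
  exact (List.pairwise_of_forall_mem_list fun e he f hf => ⟨u, h₁ e he, h₁ f hf⟩).isChain

/-- The edges meeting a path can be listed so that consecutive edges meet, starting
with any edge that extends the path. -/
theorem exists_isChain_of_isPath_of_adj [Finite V] {T : SimpleGraph V} {u v z : V}
    {p : T.Walk u v} (hp : p.IsPath) (hz : T.Adj z u) (hzp : z ∉ p.support) :
    ∃ l : List (Sym2 V), l.Nodup ∧ l.IsChain EdgesMeet ∧ l.head? = some s(z, u) ∧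
      ∀ e, e ∈ l ↔ e ∈ T.edgeSet ∧ ∃ x ∈ p.support, x ∈ e := by
  classical
  cases nonempty_fintype V
  induction p generalizing z with
  | nil =>
    rename_i u
    refine ⟨s(z, u) :: (((Finset.univ : Finset (Sym2 V)).filter
      fun e => e ∈ T.edgeSet ∧ u ∈ e ∧ e ≠ s(z, u)).toList), ?_, ?_, rfl, ?_⟩
    · simp [Finset.nodup_toList]
    · rw [← List.append_nil (_ :: _)]
      refine isChain_edgesMeet_append (u := u) ?_ (by simp) (by simp)
      simp +contextual
    · intro e
      by_cases h : e = s(z, u)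
      · subst h; simpa using hz
      · simp [h]
  | cons hadj p ih =>
    rename_i u w v
    obtain ⟨hp', hup⟩ := (SimpleGraph.Walk.cons_isPath_iff _ _).mp hp
    obtain ⟨l, hnd, hc, hhead, hmem⟩ := ih hp' hadj hup
    simp only [SimpleGraph.Walk.support_cons, List.mem_cons, not_or] at hzp
    refine ⟨s(z, u) :: (((Finset.univ : Finset (Sym2 V)).filter
      fun e => e ∈ T.edgeSet ∧ u ∈ e ∧ e ≠ s(z, u) ∧ e ∉ l).toList) ++ l, ?_, ?_, rfl, ?_⟩
    · rw [List.cons_append, List.nodup_cons]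
      refine ⟨?_, (Finset.nodup_toList _).append hnd ?_⟩
      · have : s(z, u) ∉ l := by
          rw [hmem]
          rintro ⟨-, x, hx, hxe⟩
          rcases Sym2.mem_iff.mp hxe with rfl | rfl
          · exact hzp.2 hx
          · exact hup hx
        simp [this]
      · intro e he
        simp at he
        exact he.2.2.2
    · refine isChain_edgesMeet_append (u := u) ?_ hc (by simp [hhead])
      simp +contextual
    · intro e
      by_cases h : e = s(z, u)
      · subst h; simpa using hz
      · by_cases h' : e ∈ l
        · have := (hmem e).mp h'
          simp only [List.cons_append, List.mem_cons, List.mem_append, h', or_true, true_iff]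
          exact ⟨this.1, this.2.imp fun x hx => ⟨by simp [hx.1], hx.2⟩⟩
        · have := fun h₁ h₂ => h' ((hmem e).mpr ⟨h₁, h₂⟩)
          simp only [List.cons_append, List.mem_cons, List.mem_append, h, h', or_false, false_or,
            SimpleGraph.Walk.support_cons, Finset.mem_toList, Finset.mem_filter]
          constructor
          · rintro ⟨-, h₁, h₂, -⟩
            exact ⟨h₁, u, by simp, h₂⟩
          · rintro ⟨h₁, x, rfl | hx, hxe⟩
            · exact ⟨by simp, h₁, hxe, h, not_false⟩
            · exact (this h₁ ⟨x, hx, hxe⟩).elim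

/-- The edges meeting a path can be listed so that consecutive edges meet. -/
theorem exists_isChain_of_isPath [Finite V] {T : SimpleGraph V} {u v : V}
    {p : T.Walk u v} (hp : p.IsPath) :
    ∃ l : List (Sym2 V), l.Nodup ∧ l.IsChain EdgesMeet ∧
      ∀ e, e ∈ l ↔ e ∈ T.edgeSet ∧ ∃ x ∈ p.support, x ∈ e := by
  classical
  cases nonempty_fintype V
  cases p with
  | nil =>
    refine ⟨((Finset.univ : Finset (Sym2 V)).filter
      fun e => e ∈ T.edgeSet ∧ u ∈ e).toList, Finset.nodup_toList _, ?_, by simp⟩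
    rw [← List.append_nil (Finset.toList _)]
    exact isChain_edgesMeet_append (u := u) (by simp) (by simp) (by simp)
  | cons hadj p =>
    obtain ⟨hp', hup⟩ := (SimpleGraph.Walk.cons_isPath_iff _ _).mp hp
    obtain ⟨l, hnd, hc, hhead, hmem⟩ := exists_isChain_of_isPath_of_adj hp' hadj hup
    refine ⟨((Finset.univ : Finset (Sym2 V)).filter
      fun e => e ∈ T.edgeSet ∧ u ∈ e ∧ e ∉ l).toList ++ l, ?_, ?_, ?_⟩
    · refine (Finset.nodup_toList _).append hnd fun e he => ?_
      simp at he
      exact he.2.2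
    · refine isChain_edgesMeet_append (u := u) ?_ hc (by simp [hhead])
      simp +contextual
    · intro e
      by_cases h' : e ∈ l
      · have := (hmem e).mp h'
        simp only [List.mem_append, h', or_true, true_iff]
        exact ⟨this.1, this.2.imp fun x hx => ⟨by simp [hx.1], hx.2⟩⟩
      · have := fun h₁ h₂ => h' ((hmem e).mpr ⟨h₁, h₂⟩)
        simp only [List.mem_append, h', or_false, SimpleGraph.Walk.support_cons, List.mem_cons,
          Finset.mem_toList, Finset.mem_filter]
        constructor
        · rintro ⟨-, h₁, h₂, -⟩
          exact ⟨h₁, u, by simp, h₂⟩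
        · rintro ⟨h₁, x, rfl | hx, hxe⟩
          · simp [h₁, hxe]
          · exact (this h₁ ⟨x, hx, hxe⟩).elim

/-- A vertex of a path other than its endpoints has two distinct neighbours on the path. -/
theorem SimpleGraph.Walk.IsPath.exists_adj_adj {G : SimpleGraph V} {u v x : V} {p : G.Walk u v}
    (hp : p.IsPath) (hx : x ∈ p.support) (hu : x ≠ u) (hv : x ≠ v) :
    ∃ a ∈ p.support, ∃ b ∈ p.support, a ≠ b ∧ G.Adj x a ∧ G.Adj x b := by
  obtain ⟨i, rfl, hi⟩ := SimpleGraph.Walk.mem_support_iff_exists_getVert.mp hx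
  have h0 : i ≠ 0 := by rintro rfl; simp at hu
  have hl : i ≠ p.length := by rintro rfl; simp at hv
  refine ⟨p.getVert (i - 1), p.getVert_mem_support _, p.getVert (i + 1), p.getVert_mem_support _,
    ?_, ?_, p.adj_getVert_succ (by omega)⟩
  · intro h
    have := hp.getVert_injOn (by simp; omega) (by simp; omega) h
    omega
  · have := p.adj_getVert_succ (i := i - 1) (by omega)
    rw [show i - 1 + 1 = i by omega] at this
    exact this.symm

/-- A nonempty connected graph of maximum degree at most 2 has a Hamiltonian path. -/
theorem exists_isPath_forall_mem_support [Finite V] [Nonempty V] {G : SimpleGraph V}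
    (hG : G.Preconnected) (hdeg : ∀ v, (G.neighborSet v).ncard ≤ 2) :
    ∃ (u v : V) (p : G.Walk u v), p.IsPath ∧ ∀ x, x ∈ p.support := by
  obtain ⟨u, v, p, hp, hmax⟩ :=
    SimpleGraph.Walk.exists_isPath_forall_isPath_length_le_length G
  refine ⟨u, v, p, hp, ?_⟩
  by_contra! ⟨x, hx⟩
  obtain ⟨q⟩ := hG u x
  obtain ⟨⟨⟨w, a⟩, hwa⟩, -, hw, ha⟩ :=
    q.exists_boundary_dart {y | y ∈ p.support} p.start_mem_support hx
  simp only [Set.mem_ofPred_eq] at hw ha hwa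
  have hwu : w ≠ u := by
    rintro rfl
    have := hmax _ _ _ (hp.cons ha (h := hwa.symm))
    simp at this
  have hwv : w ≠ v := by
    rintro rfl
    have := hmax _ _ _ (hp.concat ha hwa)
    simp at this
  obtain ⟨b, hb, c, hc, hbc, hwb, hwc⟩ := hp.exists_adj_adj hw hwu hwv
  have hab : a ≠ b := fun h => ha (h ▸ hb)
  have hac : a ≠ c := fun h => ha (h ▸ hc)
  have h3 : ({a, b, c} : Set V).ncard = 3 := Set.ncard_eq_three.mpr ⟨a, b, c, hab, hac, hbc, rfl⟩
  have hsub : ({a, b, c} : Set V) ⊆ G.neighborSet w := by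
    rintro y (rfl | rfl | rfl) <;> assumption
  have := Set.ncard_le_ncard hsub
  have := hdeg w
  omega

/-- If the vertices of degree at least 2 of a connected graph induce a path, then some path
of the graph meets all its edges. -/
theorem exists_isPath_meeting_edges [Finite V] [Nontrivial V] {T : SimpleGraph V}
    (hT : T.Connected)
    (hB : (T.induce {v | 2 ≤ (T.neighborSet v).ncard}).Preconnected)
    (hdeg : ∀ v, ((T.induce {v | 2 ≤ (T.neighborSet v).ncard}).neighborSet v).ncard ≤ 2) :
    ∃ (u v : V) (p : T.Walk u v), p.IsPath ∧ ∀ e ∈ T.edgeSet, ∃ x ∈ p.support, x ∈ e := by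
  by_cases hall : ∀ x y, T.Adj x y →
      2 ≤ (T.neighborSet x).ncard ∨ 2 ≤ (T.neighborSet y).ncard
  · have hne : Nonempty {v | 2 ≤ (T.neighborSet v).ncard} := by
      obtain ⟨x⟩ := hT.nonempty
      obtain ⟨y, hy⟩ := hT.preconnected.exists_adj_of_nontrivial x
      exact (hall x y hy).elim (fun h => ⟨x, h⟩) (fun h => ⟨y, h⟩)
    obtain ⟨u, v, p, hp, hmem⟩ := exists_isPath_forall_mem_support hB hdeg
    refine ⟨_, _, p.map (SimpleGraph.Embedding.induce _).toHom,
      hp.map Subtype.val_injective, ?_⟩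
    intro e he
    induction e with | _ x y
    rcases hall x y he with h | h
    · exact ⟨x, by
        rw [SimpleGraph.Walk.support_map]
        exact List.mem_map_of_mem (hmem ⟨x, h⟩), by simp⟩
    · exact ⟨y, by
        rw [SimpleGraph.Walk.support_map]
        exact List.mem_map_of_mem (hmem ⟨y, h⟩), by simp⟩
  · push Not at hall
    obtain ⟨x, y, hxy, hx, hy⟩ := hall
    have only : ∀ {a b}, T.Adj a b → (T.neighborSet a).ncard < 2 → ∀ c, T.Adj a c → c = b := by
      intro a b hab ha c hac
      exact (Set.ncard_le_one_iff (Set.toFinite _)).mp (Nat.le_of_lt_succ ha) hac hab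
    have hV : ∀ z, z = x ∨ z = y := by
      by_contra! ⟨z, hz⟩
      obtain ⟨q⟩ := hT.preconnected x z
      obtain ⟨⟨⟨w, a⟩, hwa⟩, -, hw, ha⟩ :=
        q.exists_boundary_dart {z | z = x ∨ z = y} (.inl rfl) (by simpa using hz)
      simp only [Set.mem_ofPred_eq] at hw ha hwa
      rcases hw with rfl | rfl
      · exact ha (.inr (only hxy hx _ hwa))
      · exact ha (.inl (only hxy.symm hy _ hwa))
    refine ⟨x, x, .nil, .nil, fun e he => ⟨x, by simp, ?_⟩⟩
    induction e with | _ a b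
    have hab : a ≠ b := SimpleGraph.Adj.ne he
    rcases hV a with rfl | rfl
    · simp
    · rcases hV b with rfl | rfl <;> simp_all

/-- In a connected graph, the vertices of degree at least 2 induce a connected graph. -/
theorem preconnected_induce_two_le_degree [Finite V] {T : SimpleGraph V} (hT : T.Preconnected) :
    (T.induce {v | 2 ≤ (T.neighborSet v).ncard}).Preconnected := by
  rintro ⟨u, hu⟩ ⟨v, hv⟩
  obtain ⟨p, hp⟩ := hT.exists_isPath u v
  refine ⟨p.induce _ fun x hx => ?_⟩
  by_cases hxu : x = u
  · exact hxu ▸ hu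
  by_cases hxv : x = v
  · exact hxv ▸ hv
  obtain ⟨a, -, b, -, hab, ha, hb⟩ := hp.exists_adj_adj hx hxu hxv
  have hsub : ({a, b} : Set V) ⊆ T.neighborSet x := by
    rintro y (rfl | rfl) <;> assumption
  exact (Set.ncard_pair hab).symm.trans_le (Set.ncard_le_ncard hsub)

/-- If `e` separates `S` from the remaining elements of the list `l` with respect to `R`, then
an `R`-chain ordering of `l` starts or ends in `S`. -/
theorem head_or_getLast_mem_of_isChain {α : Type*} {R : α → α → Prop} {l : List α}
    (hnd : l.Nodup) (hc : l.IsChain R) {S : Set α} {e : α} (he : e ∈ l) (heS : e ∉ S)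
    (hsep : ∀ f ∈ l, ∀ g ∈ l, R f g → f ≠ e → g ≠ e → (f ∈ S ↔ g ∈ S))
    (hne : ∃ f ∈ l, f ∈ S) :
    (∃ f ∈ l.head?, f ∈ S) ∨ ∃ f ∈ l.getLast?, f ∈ S := by
  obtain ⟨p, q, rfl⟩ := List.append_of_mem he
  have hep : e ∉ p := fun h => List.disjoint_of_nodup_append hnd h (by simp)
  have heq : e ∉ q := (List.nodup_cons.mp (List.nodup_append.mp hnd).2.1).1
  have same : ∀ r : List α, (∀ f ∈ r, f ∈ p ++ e :: q) → r.IsChain R → e ∉ r →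
      ∀ f ∈ r, ∀ g ∈ r, f ∈ S → g ∈ S := by
    intro r hr hcr her f hf g hg hfS
    have hc' : r.IsChain fun f g => f ∈ S ↔ g ∈ S := by
      refine List.isChain_iff_forall_rel_of_append_cons_cons.mpr ?_
      rintro a b r₁ r₂ rfl
      exact hsep a (hr a (by simp)) b (hr b (by simp))
        (List.isChain_iff_forall_rel_of_append_cons_cons.mp hcr rfl)
        (by rintro rfl; simp at her) (by rintro rfl; simp at her)
    have : IsTrans α fun f g => f ∈ S ↔ g ∈ S := ⟨fun _ _ _ h₁ h₂ => h₁.trans h₂⟩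
    by_contra hgS
    have hpw := hc'.pairwise
    induction hpw with
    | nil => simp at hf
    | cons => grind
  obtain ⟨f, hf, hfS⟩ := hne
  rw [List.mem_append, List.mem_cons] at hf
  rcases hf with hf | rfl | hf
  · left
    obtain ⟨a, p, rfl⟩ := List.exists_cons_of_ne_nil (List.ne_nil_of_mem hf)
    exact ⟨a, by simp, same _ (by simp +contextual) hc.left_of_append hep f hf a (by simp) hfS⟩
  · exact (heS hfS).elim
  · right
    obtain ⟨b, hb⟩ := List.getLast?_isSome.mpr (List.ne_nil_of_mem hf) |> Option.isSome_iff_exists.mp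
    refine ⟨b, ?_, same _ (by simp +contextual) hc.right_of_append.tail heq f hf b
      (List.mem_of_mem_getLast? hb) hfS⟩
    simp [List.getLast?_append, List.getLast?_cons, hb]

/-- The edges avoiding `v` in the part of `G - v` containing `a`. -/
def branch (G : SimpleGraph V) (v a : V) : Set (Sym2 V) :=
  {e | e ∈ G.edgeSet ∧ v ∉ e ∧ ∃ x ∈ e, (G.deleteEdges (G.incidenceSet v)).Reachable a x}

theorem adj_deleteEdges_incidenceSet {G : SimpleGraph V} {v x y : V} (h : G.Adj x y)
    (hv : v ∉ s(x, y)) : (G.deleteEdges (G.incidenceSet v)).Adj x y := by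
  rw [SimpleGraph.deleteEdges_adj]
  exact ⟨h, fun h' => hv h'.2⟩

theorem reachable_of_mem_branch {G : SimpleGraph V} {v a x : V} {e : Sym2 V}
    (he : e ∈ branch G v a) (hx : x ∈ e) :
    (G.deleteEdges (G.incidenceSet v)).Reachable a x := by
  obtain ⟨he, hv, y, hy, hr⟩ := he
  by_cases hxy : x = y
  · exact hxy ▸ hr
  obtain rfl := (Sym2.mem_and_mem_iff hxy).mp ⟨hx, hy⟩
  exact hr.trans (adj_deleteEdges_incidenceSet he hv).symm.reachable

/-- In an acyclic graph, distinct neighbours of `v` are separated by removing `v`. -/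
theorem eq_of_reachable_deleteEdges_incidenceSet {T : SimpleGraph V} (hT : T.IsAcyclic)
    {v a b : V} (ha : T.Adj v a) (hb : T.Adj v b)
    (h : (T.deleteEdges (T.incidenceSet v)).Reachable a b) : a = b := by
  by_contra hab
  have hbr := SimpleGraph.isAcyclic_iff_forall_adj_isBridge.mp hT ha
  rw [SimpleGraph.isBridge_iff] at hbr
  have hle : T.deleteEdges (T.incidenceSet v) ≤ T.deleteEdges {s(v, a)} :=
    SimpleGraph.deleteEdges_anti (by
      rw [Set.singleton_subset_iff]; exact ⟨ha, by simp⟩)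
  have hvb : (T.deleteEdges {s(v, a)}).Adj v b := by
    rw [SimpleGraph.deleteEdges_adj]
    refine ⟨hb, ?_⟩
    simp only [Set.mem_singleton_iff, Sym2.congr_right]
    exact fun h => hab h.symm
  exact hbr (hvb.reachable.trans (h.mono hle).symm)

theorem mem_branch_of_edgesMeet {T : SimpleGraph V} (hT : T.IsAcyclic) {v a : V}
    (ha : T.Adj v a) {e f : Sym2 V} (he : e ∈ branch T v a) (hf : f ∈ T.edgeSet)
    (hef : EdgesMeet e f) (hfa : f ≠ s(v, a)) : f ∈ branch T v a := by
  obtain ⟨x, hxe, hxf⟩ := hef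
  have hr := reachable_of_mem_branch he hxe
  refine ⟨hf, fun hvf => hfa ?_, x, hxf, hr⟩
  have hvx : v ≠ x := by rintro rfl; exact he.2.1 hxe
  obtain rfl := (Sym2.mem_and_mem_iff hvx).mp ⟨hvf, hxf⟩
  rw [eq_of_reachable_deleteEdges_incidenceSet hT ha hf hr]

/-- In an acyclic graph whose edges can be ordered so that consecutive edges meet, no vertex
has three neighbours of degree at least 2. -/
theorem ncard_neighborSet_induce_le_two [Finite V] {T : SimpleGraph V} (hT : T.IsAcyclic)
    {l : List (Sym2 V)} (hnd : l.Nodup) (hl : ∀ e, e ∈ l ↔ e ∈ T.edgeSet)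
    (hc : l.IsChain EdgesMeet) (v : {v | 2 ≤ (T.neighborSet v).ncard}) :
    ((T.induce {v | 2 ≤ (T.neighborSet v).ncard}).neighborSet v).ncard ≤ 2 := by
  by_contra! h
  obtain ⟨a, b, c, ha, hb, hc', hab, hac, hbc⟩ := (Set.two_lt_ncard_iff (Set.toFinite _)).mp h
  have hends : ∀ x : {v | 2 ≤ (T.neighborSet v).ncard},
      x ∈ (T.induce {v | 2 ≤ (T.neighborSet v).ncard}).neighborSet v →
      (∃ f ∈ l.head?, f ∈ branch T v x) ∨ ∃ f ∈ l.getLast?, f ∈ branch T v x := by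
    rintro ⟨x, hx⟩ hvx
    have hvx : T.Adj v x := hvx
    refine head_or_getLast_mem_of_isChain hnd hc ((hl s(v.1, x)).mpr hvx)
      (fun h => h.2.1 (by simp)) ?_ ?_
    · intro f hf g hg hfg hfe hge
      exact ⟨fun h => mem_branch_of_edgesMeet hT hvx h ((hl g).mp hg) hfg hge,
        fun h => mem_branch_of_edgesMeet hT hvx h ((hl f).mp hf)
          (hfg.imp fun _ h => h.symm) hfe⟩
    · obtain ⟨y, hy, hyv⟩ := Set.exists_ne_of_one_lt_ncard hx v.1
      have hxy : T.Adj x y := hy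
      refine ⟨s(x, y), (hl _).mpr hxy, hxy, ?_, x, by simp, .rfl⟩
      rw [Sym2.mem_iff]
      rintro (h | h)
      · exact hvx.ne h
      · exact hyv h.symm
  have hdisj : ∀ x y : {v | 2 ≤ (T.neighborSet v).ncard},
      x ∈ (T.induce {v | 2 ≤ (T.neighborSet v).ncard}).neighborSet v →
      y ∈ (T.induce {v | 2 ≤ (T.neighborSet v).ncard}).neighborSet v → x ≠ y →
      ∀ f, f ∈ branch T v x → f ∉ branch T v y := by
    intro x y hx hy hxy f hfx hfy
    obtain ⟨z, hz, hr⟩ := hfx.2.2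
    exact hxy (Subtype.ext (eq_of_reachable_deleteEdges_incidenceSet hT hx hy
      (hr.trans (reachable_of_mem_branch hfy hz).symm)))
  have hopt : ∀ x y : {v | 2 ≤ (T.neighborSet v).ncard},
      x ∈ (T.induce {v | 2 ≤ (T.neighborSet v).ncard}).neighborSet v →
      y ∈ (T.induce {v | 2 ≤ (T.neighborSet v).ncard}).neighborSet v → x ≠ y →
      ∀ o : Option (Sym2 V), (∃ f ∈ o, f ∈ branch T v x) → ¬ ∃ f ∈ o, f ∈ branch T v y := by
    rintro x y hx hy hxy o ⟨f, hf, hfx⟩ ⟨g, hg, hgy⟩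
    obtain rfl := Option.mem_unique hf hg
    exact hdisj x y hx hy hxy f hfx hgy
  have hab' := hopt a b ha hb hab
  have hac' := hopt a c ha hc' hac
  have hbc' := hopt b c hb hc' hbc
  rcases hends a ha with h₁ | h₁ <;> rcases hends b hb with h₂ | h₂ <;>
    rcases hends c hc' with h₃ | h₃ <;>
    first | exact hab' _ h₁ h₂ | exact hac' _ h₁ h₃ | exact hbc' _ h₂ h₃

end Graphs

/-- Theorem 3.2: some permutation is the product of exactly one edge
ordering of the tree `T` iff `T` is a caterpillar. -/
theorem stmt6 (n : ℕ) (hn : 2 ≤ n) (T : SimpleGraph (Fin n)) (hT : T.IsTree) :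
    (∃ c : Equiv.Perm (Fin n), ∃! l, IsEdgeOrdering T l ∧ listProd l = c)
      ↔ IsCaterpillar T := by
  constructor
  · rintro ⟨_, l, ⟨hl, rfl⟩, huniq⟩
    have hc := isChain_edgesMeet_of_unique hl fun l' h₁ h₂ => huniq l' ⟨h₁, h₂⟩
    exact ⟨hT.isAcyclic.induce _, preconnected_induce_two_le_degree hT.connected.preconnected,
      ncard_neighborSet_induce_le_two hT.isAcyclic hl.1 hl.2 hc⟩
  · rintro ⟨-, hpre, hdeg⟩
    have : Nontrivial (Fin n) := Fin.nontrivial_iff_two_le.mpr hn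
    obtain ⟨u, v, p, hp, hmeet⟩ := exists_isPath_meeting_edges hT.connected hpre hdeg
    obtain ⟨l, hnd, hc, hmem⟩ := exists_isChain_of_isPath hp
    have hl : IsEdgeOrdering T l :=
      ⟨hnd, fun e => (hmem e).trans ⟨fun h => h.1, fun h => ⟨h, hmeet e h⟩⟩⟩
    refine ⟨listProd l, l, ⟨hl, rfl⟩, fun l' ⟨hl', hprod⟩ => ?_⟩
    refine eq_of_listProd_eq hT.isAcyclic hnd (fun e he => (hl.2 e).mp he) hc ?_ hprod
    exact (List.perm_ext_iff_of_nodup hl'.1 hnd).mpr fun e => (hl'.2 e).trans (hl.2 e).symm
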